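/- Let Ω ⊂ ℝ^n (n ≥ 2) be a bounded open set admitting a Green function G such that for every c ∈ Ω the function G(·,c) extends to a continuously differentiable function on cl(Ω) \ {c}, and such that for all distinct a, b ∈ Ω the function x ↦ ⟨∇_x G(x,a), ∇_x G(x,b)⟩ is integrable on Ω. Then the Green function is symmetric: G(a,b) = G(b,a) for all distinct a, b ∈ Ω. -/

import Mathlib

open MeasureTheory
open scoped BigOperators

/-- The partial derivative `∂f/∂xᵢ` of a function on Euclidean space. -/
noncomputable def pd {n : ℕ} (f : EuclideanSpace ℝ (Fin n) → ℝ) (i : Fin n)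
    (x : EuclideanSpace ℝ (Fin n)) : ℝ :=
  fderiv ℝ f x (EuclideanSpace.single i 1)

/-- The Laplacian `Δf = ∑ᵢ ∂²f/∂xᵢ²`. -/
noncomputable def lap {n : ℕ} (f : EuclideanSpace ℝ (Fin n) → ℝ)
    (x : EuclideanSpace ℝ (Fin n)) : ℝ :=
  ∑ i, pd (pd f i) i x

/-- `G` is a Green function for the (bounded, open) set `Ω ⊆ ℝ^n`: for each pole `a ∈ Ω`,
`G(·,a)` is smooth off the pole and locally integrable, satisfies `−ΔG(·,a) = δ_a` in the
distributional sense, and extends continuously to `cl(Ω) \ {a}` with value `0` on `∂Ω`. -/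
structure IsGreen (n : ℕ) (Ω : Set (EuclideanSpace ℝ (Fin n)))
    (G : EuclideanSpace ℝ (Fin n) → EuclideanSpace ℝ (Fin n) → ℝ) : Prop where
  smooth : ∀ a ∈ Ω, ContDiffOn ℝ (⊤ : ℕ∞) (fun x => G x a) (Ω \ {a})
  locInt : ∀ a ∈ Ω, LocallyIntegrableOn (fun x => G x a) Ω volume
  distrib : ∀ a ∈ Ω, ∀ φ : EuclideanSpace ℝ (Fin n) → ℝ,
      ContDiff ℝ (⊤ : ℕ∞) φ → HasCompactSupport φ → tsupport φ ⊆ Ω →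
      (∫ x in Ω, G x a * lap φ x) = -φ a
  boundary : ∀ a ∈ Ω, ∃ Gbar : EuclideanSpace ℝ (Fin n) → ℝ,
      ContinuousOn Gbar (closure Ω \ {a}) ∧
      (∀ x ∈ Ω \ {a}, Gbar x = G x a) ∧
      (∀ x ∈ frontier Ω, Gbar x = 0)

open scoped Topology
open Filter Set

section Calculus

variable {n : ℕ}

local notation "𝔼" => EuclideanSpace ℝ (Fin n)

/-- The pointwise inner product of the gradients of two functions. -/
noncomputable def gradDot (f g : 𝔼 → ℝ) (x : 𝔼) : ℝ :=
  ∑ i, pd f i x * pd g i x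

/-- Smooth functions with compact support in `O`. -/
structure IsTest (O : Set 𝔼) (φ : 𝔼 → ℝ) : Prop where
  smooth : ContDiff ℝ (⊤ : ℕ∞) φ
  compact : HasCompactSupport φ
  supp : tsupport φ ⊆ O

theorem gradDot_comm (f g : 𝔼 → ℝ) (x : 𝔼) : gradDot f g x = gradDot g f x := by
  simp only [gradDot, mul_comm]

theorem pd_congr {f g : 𝔼 → ℝ} {x : 𝔼} (h : f =ᶠ[𝓝 x] g) (i : Fin n) :
    pd f i x = pd g i x := by
  simp only [pd, h.fderiv_eq]

theorem pd_eventuallyEq {f g : 𝔼 → ℝ} {x : 𝔼} (h : f =ᶠ[𝓝 x] g) (i : Fin n) :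
    pd f i =ᶠ[𝓝 x] pd g i :=
  h.eventuallyEq_nhds.mono fun _ hy => pd_congr hy i

theorem gradDot_congr {f₁ f₂ g₁ g₂ : 𝔼 → ℝ} {x : 𝔼} (hf : f₁ =ᶠ[𝓝 x] f₂)
    (hg : g₁ =ᶠ[𝓝 x] g₂) : gradDot f₁ g₁ x = gradDot f₂ g₂ x := by
  simp only [gradDot, pd_congr hf, pd_congr hg]

theorem lap_congr {f g : 𝔼 → ℝ} {x : 𝔼} (h : f =ᶠ[𝓝 x] g) : lap f x = lap g x := by
  simp only [lap]
  exact Finset.sum_congr rfl fun i _ => pd_congr (pd_eventuallyEq h i) i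

theorem pd_const (c : ℝ) (i : Fin n) (x : 𝔼) : pd (fun _ => c) i x = 0 := by
  simp [pd]

theorem gradDot_const_right (f : 𝔼 → ℝ) (c : ℝ) (x : 𝔼) : gradDot f (fun _ => c) x = 0 := by
  simp [gradDot, pd_const]

theorem pd_mul {f g : 𝔼 → ℝ} {x : 𝔼} (hf : DifferentiableAt ℝ f x)
    (hg : DifferentiableAt ℝ g x) (i : Fin n) :
    pd (fun y => f y * g y) i x = f x * pd g i x + g x * pd f i x := by
  simp [pd, fderiv_fun_mul hf hg]

theorem gradDot_mul_right {f g : 𝔼 → ℝ} {x : 𝔼} (h : 𝔼 → ℝ) (hf : DifferentiableAt ℝ f x)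
    (hg : DifferentiableAt ℝ g x) :
    gradDot h (fun y => f y * g y) x = f x * gradDot h g x + g x * gradDot h f x := by
  simp only [gradDot, pd_mul hf hg, Finset.mul_sum, ← Finset.sum_add_distrib]
  exact Finset.sum_congr rfl fun i _ => by ring

theorem gradDot_add_right {f g : 𝔼 → ℝ} {x : 𝔼} (h : 𝔼 → ℝ) (hf : DifferentiableAt ℝ f x)
    (hg : DifferentiableAt ℝ g x) :
    gradDot h (fun y => f y + g y) x = gradDot h f x + gradDot h g x := by
  simp only [gradDot, pd, fderiv_fun_add hf hg, ← Finset.sum_add_distrib]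
  exact Finset.sum_congr rfl fun i _ => by simp; ring

theorem gradDot_const_sub_right (h f : 𝔼 → ℝ) (c : ℝ) (x : 𝔼) :
    gradDot h (fun y => c - f y) x = -gradDot h f x := by
  simp only [gradDot, pd, fderiv_const_sub, ← Finset.sum_neg_distrib]
  exact Finset.sum_congr rfl fun i _ => by simp

theorem gradDot_comp_right {f : 𝔼 → ℝ} {ψ : ℝ → ℝ} {x : 𝔼} (h : 𝔼 → ℝ)
    (hψ : DifferentiableAt ℝ ψ (f x)) (hf : DifferentiableAt ℝ f x) :
    gradDot h (fun y => ψ (f y)) x = deriv ψ (f x) * gradDot h f x := by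
  have h1 : fderiv ℝ (fun y => ψ (f y)) x = deriv ψ (f x) • fderiv ℝ f x :=
    (hψ.hasDerivAt.comp_hasFDerivAt x hf.hasFDerivAt).fderiv
  simp only [gradDot, pd, h1, Finset.mul_sum]
  exact Finset.sum_congr rfl fun i _ => by simp; ring

theorem ContDiffOn.pd {O : Set 𝔼} {f : 𝔼 → ℝ} (hf : ContDiffOn ℝ (⊤ : ℕ∞) f O) (hO : IsOpen O)
    (i : Fin n) : ContDiffOn ℝ (⊤ : ℕ∞) (pd f i) O :=
  (hf.fderiv_of_isOpen hO (by simp)).clm_apply contDiffOn_const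

theorem ContDiffOn.lap {O : Set 𝔼} {f : 𝔼 → ℝ} (hf : ContDiffOn ℝ (⊤ : ℕ∞) f O)
    (hO : IsOpen O) : ContDiffOn ℝ (⊤ : ℕ∞) (lap f) O :=
  ContDiffOn.sum fun i _ => (hf.pd hO i).pd hO i

theorem tsupport_pd_subset (f : 𝔼 → ℝ) (i : Fin n) : tsupport (pd f i) ⊆ tsupport f := by
  refine closure_minimal (fun x hx => ?_) (isClosed_tsupport f)
  by_contra h
  rw [notMem_tsupport_iff_eventuallyEq] at h
  exact hx ((pd_congr h i).trans (pd_const 0 i x))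

theorem IsTest.mono {O U : Set 𝔼} {φ : 𝔼 → ℝ} (h : IsTest O φ) (hO : O ⊆ U) : IsTest U φ :=
  ⟨h.smooth, h.compact, h.supp.trans hO⟩

theorem IsTest.pd {O : Set 𝔼} {φ : 𝔼 → ℝ} (h : IsTest O φ) (i : Fin n) : IsTest O (pd φ i) where
  smooth := contDiffOn_univ.1 (h.smooth.contDiffOn.pd isOpen_univ i)
  compact := h.compact.of_isClosed_subset (isClosed_tsupport _) (tsupport_pd_subset φ i)
  supp := (tsupport_pd_subset φ i).trans h.supp

theorem IsTest.differentiable {O : Set 𝔼} {φ : 𝔼 → ℝ} (h : IsTest O φ) : Differentiable ℝ φ :=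
  h.smooth.differentiable (by simp)

theorem ContDiffOn.differentiableAt_of_isOpen {O : Set 𝔼} {f : 𝔼 → ℝ}
    (hf : ContDiffOn ℝ (⊤ : ℕ∞) f O) (hO : IsOpen O) {x : 𝔼} (hx : x ∈ O) :
    DifferentiableAt ℝ f x :=
  (hf.contDiffAt (hO.mem_nhds hx)).differentiableAt (by simp)

theorem IsTest.mul {O : Set 𝔼} {φ f : 𝔼 → ℝ} (h : IsTest O φ) (hO : IsOpen O)
    (hf : ContDiffOn ℝ (⊤ : ℕ∞) f O) : IsTest O (fun x => φ x * f x) where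
  smooth := by
    rw [contDiff_iff_contDiffAt]
    intro x
    by_cases hx : x ∈ tsupport φ
    · exact h.smooth.contDiffAt.mul (hf.contDiffAt (hO.mem_nhds (h.supp hx)))
    · rw [notMem_tsupport_iff_eventuallyEq] at hx
      refine (contDiffAt_const (c := (0 : ℝ))).congr_of_eventuallyEq ?_
      filter_upwards [hx] with y hy
      simp [hy]
  compact := h.compact.mul_right
  supp := (tsupport_mul_subset_left (f := φ) (g := f)).trans h.supp

theorem IsTest.integrable {O : Set 𝔼} {φ : 𝔼 → ℝ} (h : IsTest O φ) : Integrable φ :=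
  h.smooth.continuous.integrable_of_hasCompactSupport h.compact

theorem IsTest.integrable_mul {O : Set 𝔼} {φ f : 𝔼 → ℝ} (h : IsTest O φ) (hO : IsOpen O)
    (hf : ContDiffOn ℝ (⊤ : ℕ∞) f O) : Integrable (fun x => f x * φ x) := by
  simpa only [mul_comm] using (h.mul hO hf).integrable

theorem integrable_gradDot {O : Set 𝔼} {φ f : 𝔼 → ℝ} (h : IsTest O φ) (hO : IsOpen O)
    (hf : ContDiffOn ℝ (⊤ : ℕ∞) f O) : Integrable (gradDot f φ) :=
  integrable_finsetSum _ fun i _ => (h.pd i).integrable_mul hO (hf.pd hO i)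

theorem integral_mul_pd {O : Set 𝔼} {φ f : 𝔼 → ℝ} (h : IsTest O φ) (hO : IsOpen O)
    (hf : ContDiffOn ℝ (⊤ : ℕ∞) f O) (i : Fin n) :
    ∫ x, f x * pd φ i x = -∫ x, pd f i x * φ x :=
  integral_mul_fderiv_eq_neg_fderiv_mul_of_integrable
    (h.integrable_mul hO (hf.pd hO i)) ((h.pd i).integrable_mul hO hf) (h.integrable_mul hO hf)
    (fun _ hx => hf.differentiableAt_of_isOpen hO (h.supp hx)) (fun _ _ => h.differentiable _)

theorem integral_mul_lap {O : Set 𝔼} {φ f : 𝔼 → ℝ} (h : IsTest O φ) (hO : IsOpen O)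
    (hf : ContDiffOn ℝ (⊤ : ℕ∞) f O) : ∫ x, f x * lap φ x = -∫ x, gradDot f φ x := by
  simp only [lap, gradDot, Finset.mul_sum]
  rw [integral_finsetSum _ fun i _ => ((h.pd i).pd i).integrable_mul hO hf,
    integral_finsetSum _ fun i _ => (h.pd i).integrable_mul hO (hf.pd hO i),
    ← Finset.sum_neg_distrib]
  exact Finset.sum_congr rfl fun i _ => integral_mul_pd (h.pd i) hO hf i

theorem integral_lap_mul {O : Set 𝔼} {φ f : 𝔼 → ℝ} (h : IsTest O φ) (hO : IsOpen O)
    (hf : ContDiffOn ℝ (⊤ : ℕ∞) f O) : ∫ x, lap f x * φ x = -∫ x, gradDot f φ x := by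
  simp only [lap, gradDot, Finset.sum_mul]
  rw [integral_finsetSum _ fun i _ => h.integrable_mul hO ((hf.pd hO i).pd hO i),
    integral_finsetSum _ fun i _ => (h.pd i).integrable_mul hO (hf.pd hO i),
    ← Finset.sum_neg_distrib]
  refine Finset.sum_congr rfl fun i _ => ?_
  rw [integral_mul_pd h hO (hf.pd hO i) i, neg_neg]

/-- The partial derivatives of a smooth function vanish almost everywhere on its zero set. -/
theorem ae_pd_eq_zero_of_eq_zero {O : Set 𝔼} {f : 𝔼 → ℝ} (hO : IsOpen O)
    (hf : ContDiffOn ℝ (⊤ : ℕ∞) f O) (i : Fin n) :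
    ∀ᵐ x, x ∈ O → f x = 0 → pd f i x = 0 := by
  set e : 𝔼 := EuclideanSpace.single i 1 with he
  set s : Set 𝔼 := f ⁻¹' {0} ∩ O with hs
  have hms : MeasurableSet s := by
    obtain ⟨u, hu, h⟩ := continuousOn_iff_isClosed.1 hf.continuousOn {0} isClosed_singleton
    rw [hs, h]
    exact hu.measurableSet.inter hO.measurableSet
  have happ : ApproximatesLinearOn (fun x => f x • e) (0 : 𝔼 →L[ℝ] 𝔼) s 0 := by
    intro x hx y hy
    have h1 : f x = 0 := hx.1
    have h2 : f y = 0 := hy.1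
    simp [h1, h2]
  have key := happ.norm_fderiv_sub_le volume hms (fun x => (fderiv ℝ f x).smulRight e)
    fun x hx => ((hf.differentiableAt_of_isOpen hO hx.2).hasFDerivAt.smul_const e).hasFDerivWithinAt
  rw [ae_restrict_iff' hms] at key
  filter_upwards [key] with x hx hxO hx0
  have h1 := hx ⟨hx0, hxO⟩
  simp only [sub_zero, nonpos_iff_eq_zero, nnnorm_eq_zero] at h1
  have h2 := congrArg (fun T : 𝔼 →L[ℝ] 𝔼 => T e i) h1
  simpa [he, pd] using h2

theorem ae_gradDot_eq_zero_of_eq_zero {O : Set 𝔼} {f : 𝔼 → ℝ} (hO : IsOpen O)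
    (hf : ContDiffOn ℝ (⊤ : ℕ∞) f O) (h : 𝔼 → ℝ) :
    ∀ᵐ x, x ∈ O → f x = 0 → gradDot h f x = 0 := by
  filter_upwards [ae_all_iff.2 (ae_pd_eq_zero_of_eq_zero hO hf)] with x hx hxO hx0
  simp [gradDot, hx _ hxO hx0]

end Calculus

/-- A smooth function vanishing near `0`, equal to the identity away from `0`. -/
theorem exists_truncation : ∃ ψ : ℝ → ℝ, ∃ C : ℝ, ContDiff ℝ (⊤ : ℕ∞) ψ ∧
    (∀ t, |t| ≤ 1 → ψ t = 0) ∧ (∀ t, 2 < |t| → ψ t = t) ∧ (∀ t, |ψ t| ≤ |t|) ∧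
    ∀ t, |deriv ψ t| ≤ C := by
  let β : ContDiffBump (0 : ℝ) := ⟨1, 2, one_pos, one_lt_two⟩
  have hβ : ContDiff ℝ (⊤ : ℕ∞) β := β.contDiff
  set ψ : ℝ → ℝ := fun t => t * (1 - β t) with hψ
  have hψs : ContDiff ℝ (⊤ : ℕ∞) ψ := contDiff_id.mul (contDiff_const.sub hβ)
  have h2 : ∀ t, 2 < |t| → ψ t = t := by
    intro t ht
    have : β t = 0 := β.zero_of_le_dist (by simpa [β] using ht.le)
    simp [hψ, this]
  have hc : Continuous (deriv ψ) := hψs.continuous_deriv (by simp)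
  obtain ⟨C, hC⟩ := (isCompact_Icc (a := (-2 : ℝ)) (b := 2)).exists_bound_of_continuousOn
    hc.continuousOn
  refine ⟨ψ, max C 1, hψs, ?_, h2, ?_, ?_⟩
  · intro t ht
    have : β t = 1 := β.one_of_mem_closedBall (by simpa [β] using ht)
    simp [hψ, this]
  · intro t
    simp only [hψ, abs_mul]
    refine mul_le_of_le_one_right (abs_nonneg t) ?_
    rw [abs_le]
    constructor <;> linarith [β.nonneg (x := t), β.le_one (x := t)]
  · intro t
    rcases le_or_gt |t| 2 with ht | ht
    · exact (hC t (abs_le.1 ht)).trans (le_max_left _ _)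
    · have : ψ =ᶠ[𝓝 t] id := by
        filter_upwards [(isOpen_lt continuous_const continuous_abs).mem_nhds ht] with s hs
        exact h2 s hs
      rw [this.deriv_eq]
      simp

section Pole

variable {n : ℕ}

local notation "𝔼" => EuclideanSpace ℝ (Fin n)

/-- A smooth cutoff, equal to one near a point of an open set. -/
theorem exists_isTest_eventuallyEq_one {O : Set 𝔼} {c : 𝔼} (hO : IsOpen O) (hc : c ∈ O) :
    ∃ χ : 𝔼 → ℝ, IsTest O χ ∧ (χ =ᶠ[𝓝 c] fun _ => 1) ∧ ∀ x, χ x ∈ Icc (0 : ℝ) 1 := by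
  obtain ⟨r, hr, hrO⟩ := Metric.nhds_basis_closedBall.mem_iff.1 (hO.mem_nhds hc)
  let β : ContDiffBump c := ⟨r / 2, r, half_pos hr, half_lt_self hr⟩
  exact ⟨β, ⟨β.contDiff, β.hasCompactSupport, by rw [β.tsupport_eq]; exact hrO⟩,
    β.eventuallyEq_one, fun x => ⟨β.nonneg, β.le_one⟩⟩

/-- `u` is the extension by zero of a Green function of `Ω` with pole `a`. -/
structure IsPole (Ω : Set 𝔼) (a : 𝔼) (u : 𝔼 → ℝ) : Prop where
  isOpen : IsOpen Ω
  smooth : ContDiffOn ℝ (⊤ : ℕ∞) u (Ω \ {a})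
  zero : ∀ x ∉ Ω, u x = 0
  cont : ContinuousOn u {a}ᶜ
  distrib : ∀ φ, IsTest Ω φ → ∫ x, u x * lap φ x = -φ a

variable {Ω : Set (EuclideanSpace ℝ (Fin n))} {a b : EuclideanSpace ℝ (Fin n)}
  {u v χ : EuclideanSpace ℝ (Fin n) → ℝ}

theorem IsPole.isOpen_diff (hu : IsPole Ω a u) : IsOpen (Ω \ {a}) :=
  hu.isOpen.sdiff isClosed_singleton

theorem IsPole.integral_gradDot (hu : IsPole Ω a u) {φ : 𝔼 → ℝ} (hφ : IsTest (Ω \ {a}) φ) :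
    ∫ x, gradDot u φ x = 0 := by
  have h1 := hu.distrib φ (hφ.mono sdiff_subset)
  have h2 : φ a = 0 := image_eq_zero_of_notMem_tsupport fun h => (hφ.supp h).2 rfl
  rw [integral_mul_lap hφ hu.isOpen_diff hu.smooth, h2] at h1
  linarith

theorem IsPole.ae_lap_eq_zero (hu : IsPole Ω a u) : ∀ᵐ x, x ∈ Ω \ {a} → lap u x = 0 := by
  refine hu.isOpen_diff.ae_eq_zero_of_integral_contDiff_smul_eq_zero
    ((hu.smooth.lap hu.isOpen_diff).continuousOn.locallyIntegrableOn
      hu.isOpen_diff.measurableSet) fun φ h1 h2 h3 => ?_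
  have hφ : IsTest (Ω \ {a}) φ := ⟨h1, h2, h3⟩
  have := integral_lap_mul hφ hu.isOpen_diff hu.smooth
  rw [hu.integral_gradDot hφ, neg_zero] at this
  simpa only [smul_eq_mul, mul_comm] using this

/-- Green's representation of `u b` as a flux through the transition region of a cutoff. -/
theorem IsPole.apply_eq_integral (hu : IsPole Ω a u) (hv : IsPole Ω b v) (hχ : IsTest Ω χ)
    (ha : χ =ᶠ[𝓝 a] fun _ => 0) (hb : χ =ᶠ[𝓝 b] fun _ => 1) :
    u b = ∫ x, (u x * gradDot v χ x - v x * gradDot u χ x) := by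
  have haχ : a ∉ tsupport χ := by rwa [notMem_tsupport_iff_eventuallyEq]
  have hbΩ : b ∈ Ω := hχ.supp <| subset_tsupport _ <| by simp [hb.eq_of_nhds]
  have hχa : IsTest (Ω \ {a}) χ := ⟨hχ.smooth, hχ.compact, fun x hx =>
    ⟨hχ.supp hx, fun h => haχ (h ▸ hx)⟩⟩
  obtain ⟨N, hN, hNo, hbN⟩ := eventually_nhds_iff.1 hb
  have hNnhds : ∀ x ∈ N, χ =ᶠ[𝓝 x] fun _ => 1 := fun x hx =>
    eventually_nhds_iff.2 ⟨N, hN, hNo, hx⟩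
  obtain ⟨ρ, ⟨hρs, -, hρN⟩, hρb, -⟩ := exists_isTest_eventuallyEq_one hNo hbN
  have hw : ContDiffOn ℝ (⊤ : ℕ∞) (fun x => (1 - ρ x) * v x) Ω := by
    intro x hx
    refine ContDiffAt.contDiffWithinAt ?_
    by_cases hxb : x = b
    · refine (contDiffAt_const (c := (0 : ℝ))).congr_of_eventuallyEq ?_
      subst hxb
      filter_upwards [hρb] with y hy
      simp [hy]
    · exact (contDiffAt_const.sub hρs.contDiffAt).mul
        (hv.smooth.contDiffAt (hv.isOpen_diff.mem_nhds ⟨hx, hxb⟩))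
  set w : 𝔼 → ℝ := fun x => (1 - ρ x) * v x with hwdef
  have hwv : ∀ x ∉ N, w =ᶠ[𝓝 x] v := by
    intro x hx
    filter_upwards [notMem_tsupport_iff_eventuallyEq.1 fun h => hx (hρN h)] with y hy
    simp [hwdef, hy]
  have hφ : IsTest (Ω \ {a}) (fun x => χ x * u x) := hχa.mul hu.isOpen_diff hu.smooth
  have hφ' := hφ.mono (U := Ω) sdiff_subset
  have hχw : IsTest (Ω \ {a}) (fun x => χ x * w x) :=
    hχa.mul hu.isOpen_diff (hw.mono sdiff_subset)
  have e1 : ∫ x, v x * lap (fun y => χ y * u y) x = -u b := by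
    rw [hv.distrib _ hφ', hb.eq_of_nhds, one_mul]
  have e2 : ∫ x, v x * lap (fun y => χ y * u y) x = ∫ x, w x * lap (fun y => χ y * u y) x := by
    refine integral_congr_ae ?_
    filter_upwards [hu.ae_lap_eq_zero] with x hx
    by_cases hxN : x ∈ N
    · have h1 : (fun y => χ y * u y) =ᶠ[𝓝 x] u := by
        filter_upwards [hNnhds x hxN] with y hy
        rw [hy, one_mul]
      have h2 : x ∈ Ω \ {a} := hχa.supp <| subset_tsupport _ <| by simp [hN x hxN]
      rw [lap_congr h1, hx h2, mul_zero, mul_zero]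
    · rw [(hwv x hxN).eq_of_nhds]
  have e3 := hu.integral_gradDot hχw
  rw [e2, integral_mul_lap hφ' hu.isOpen hw, neg_inj] at e1
  rw [← e1, ← sub_zero (∫ x, gradDot w _ x), ← e3,
    ← integral_sub (integrable_gradDot hφ' hu.isOpen hw)
      (integrable_gradDot hχw hu.isOpen_diff hu.smooth)]
  refine integral_congr_ae (Eventually.of_forall fun x => ?_)
  have hloc : u x * gradDot w χ x - w x * gradDot u χ x
      = u x * gradDot v χ x - v x * gradDot u χ x := by
    by_cases hxN : x ∈ N
    · simp only [gradDot_congr (EventuallyEq.refl _ _) (hNnhds x hxN), gradDot_const_right,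
        mul_zero]
    · rw [gradDot_congr (hwv x hxN) (EventuallyEq.refl _ _), (hwv x hxN).eq_of_nhds]
  simp only
  rw [← hloc]
  by_cases hx : x ∈ tsupport χ
  · have hxΩ := hχa.supp hx
    have hχd := hχ.differentiable x
    rw [gradDot_mul_right w hχd (hu.smooth.differentiableAt_of_isOpen hu.isOpen_diff hxΩ),
      gradDot_mul_right u hχd (hw.differentiableAt_of_isOpen hu.isOpen hxΩ.1), gradDot_comm w u]
    ring
  · have h0 : χ =ᶠ[𝓝 x] fun _ => 0 := notMem_tsupport_iff_eventuallyEq.1 hx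
    have hmul : ∀ g : 𝔼 → ℝ, (fun y => χ y * g y) =ᶠ[𝓝 x] fun _ => 0 := by
      intro g
      filter_upwards [h0] with y hy
      rw [hy, zero_mul]
    simp only [gradDot_congr (EventuallyEq.refl _ _) (hmul _),
      gradDot_congr (EventuallyEq.refl _ _) h0, gradDot_const_right, mul_zero]

theorem integrable_mul_gradDot (hu : IsPole Ω a u) (hv : IsPole Ω b v) (hχ : IsTest Ω χ)
    {ca cb : ℝ} (ha : χ =ᶠ[𝓝 a] fun _ => ca) (hb : χ =ᶠ[𝓝 b] fun _ => cb) :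
    Integrable (fun x => u x * gradDot v χ x) := by
  have hO : IsOpen ((Ω \ {a}) \ {b}) := hu.isOpen_diff.sdiff isClosed_singleton
  have hu' := hu.smooth.mono (sdiff_subset : (Ω \ {a}) \ {b} ⊆ Ω \ {a})
  have hv' := hv.smooth.mono (sdiff_subset_sdiff_left sdiff_subset : (Ω \ {a}) \ {b} ⊆ Ω \ {b})
  have hnot : ∀ (i : Fin n) (y : 𝔼) (c : ℝ), χ =ᶠ[𝓝 y] (fun _ => c) → y ∉ tsupport (pd χ i) := by
    intro i y c h
    rw [notMem_tsupport_iff_eventuallyEq]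
    exact (pd_eventuallyEq h i).trans (Eventually.of_forall fun x => pd_const c i x)
  have ht : ∀ i, IsTest ((Ω \ {a}) \ {b}) (pd χ i) := fun i =>
    ⟨(hχ.pd i).smooth, (hχ.pd i).compact, fun x hx => ⟨⟨(hχ.pd i).supp hx,
      fun h => hnot i a ca ha (h ▸ hx)⟩, fun h => hnot i b cb hb (h ▸ hx)⟩⟩
  simp only [gradDot, Finset.mul_sum, ← mul_assoc]
  exact integrable_finsetSum _ fun i _ => (ht i).integrable_mul hO (hu'.mul (hv'.pd hO i))

theorem IsPole.isTest_mul_truncation (hv : IsPole Ω b v) (hΩ : Bornology.IsBounded Ω)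
    {θ : 𝔼 → ℝ} (hθ : ContDiff ℝ (⊤ : ℕ∞) θ) (ha : a ∉ tsupport θ) (hb : b ∉ tsupport θ)
    {ψ : ℝ → ℝ} (hψ : ContDiff ℝ (⊤ : ℕ∞) ψ) {ε : ℝ} (hε : 0 < ε)
    (h0 : ∀ t, |t| ≤ ε → ψ t = 0) : IsTest (Ω \ {a}) (fun x => θ x * ψ (v x)) := by
  have hcl : IsClosed {x ∈ tsupport θ | ε ≤ |v x|} := by
    have hc : ContinuousOn (fun x => |v x|) (tsupport θ) :=
      (hv.cont.mono fun x hx h => hb (h ▸ hx)).abs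
    exact hc.preimage_isClosed_of_isClosed (isClosed_tsupport θ) isClosed_Ici
  have hsub : {x ∈ tsupport θ | ε ≤ |v x|} ⊆ (Ω \ {b}) \ {a} := by
    rintro x ⟨hx, hxε⟩
    refine ⟨⟨?_, fun h => hb (h ▸ hx)⟩, fun h => ha (h ▸ hx)⟩
    by_contra h
    rw [hv.zero x h, abs_zero] at hxε
    exact absurd hε hxε.not_gt
  have hts : tsupport (fun x => θ x * ψ (v x)) ⊆ {x ∈ tsupport θ | ε ≤ |v x|} := by
    refine closure_minimal (fun x hx => ⟨subset_tsupport _ (left_ne_zero_of_mul hx), ?_⟩) hcl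
    by_contra h
    exact right_ne_zero_of_mul hx (h0 _ (not_le.1 h).le)
  refine ⟨?_, ?_, fun x hx => ⟨(hsub (hts hx)).1.1, (hsub (hts hx)).2⟩⟩
  · rw [contDiff_iff_contDiffAt]
    intro x
    by_cases hx : x ∈ tsupport (fun x => θ x * ψ (v x))
    · exact hθ.contDiffAt.mul (hψ.contDiffAt.comp x
        (hv.smooth.contDiffAt (hv.isOpen_diff.mem_nhds (hsub (hts hx)).1)))
    · exact (contDiffAt_const (c := (0 : ℝ))).congr_of_eventuallyEq
        (notMem_tsupport_iff_eventuallyEq.1 hx)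
  · exact Metric.isCompact_of_isClosed_isBounded (isClosed_tsupport _)
      (hΩ.subset fun x hx => (hsub (hts hx)).1.1)

theorem IsPole.setIntegral_mul_gradDot_cutoff (hΩ : Bornology.IsBounded Ω) (hu : IsPole Ω a u)
    (hv : IsPole Ω b v) (hχ : IsTest Ω χ)
    (ha : χ =ᶠ[𝓝 a] fun _ => 1) (hb : χ =ᶠ[𝓝 b] fun _ => 1) (h1 : ∀ x, |1 - χ x| ≤ 1)
    (hint : IntegrableOn (gradDot u v) Ω) :
    ∫ x in Ω, v x * gradDot u χ x = ∫ x in Ω, (1 - χ x) * gradDot u v x := by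
  obtain ⟨ψ, C, hψ, hψ0, hψ1, hψle, hψC⟩ := exists_truncation
  have hθ : ContDiff ℝ (⊤ : ℕ∞) (fun x => 1 - χ x) := contDiff_const.sub hχ.smooth
  have hnear : ∀ c, (χ =ᶠ[𝓝 c] fun _ => 1) → c ∉ tsupport (fun x => 1 - χ x) := by
    intro c hc
    rw [notMem_tsupport_iff_eventuallyEq]
    filter_upwards [hc] with y hy
    simp [hy]
  have hk : ∀ k : ℕ, (0 : ℝ) < k + 1 := fun k => k.cast_add_one_pos
  set τ : ℕ → ℝ → ℝ := fun k t => ((k : ℝ) + 1)⁻¹ * ψ (((k : ℝ) + 1) * t) with hτ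
  have hτs : ∀ k, ContDiff ℝ (⊤ : ℕ∞) (τ k) := fun k =>
    contDiff_const.mul (hψ.comp (contDiff_const.mul contDiff_id))
  have hτd : ∀ k t, deriv (τ k) t = deriv ψ (((k : ℝ) + 1) * t) := by
    intro k t
    have h1 : HasDerivAt ψ (deriv ψ (((k : ℝ) + 1) * t)) (((k : ℝ) + 1) * t) :=
      (hψ.differentiable (by simp) _).hasDerivAt
    have h2 : HasDerivAt (fun s : ℝ => ((k : ℝ) + 1) * s) ((k : ℝ) + 1) t := by
      simpa using (hasDerivAt_id t).const_mul ((k : ℝ) + 1)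
    have h3 : HasDerivAt (τ k) _ t := (h1.comp t h2).const_mul ((k : ℝ) + 1)⁻¹
    rw [h3.deriv, mul_comm (deriv ψ _),
      inv_mul_cancel_left₀ (hk k).ne']
  have hτ0 : ∀ (k : ℕ) (t : ℝ), |t| ≤ ((k : ℝ) + 1)⁻¹ → τ k t = 0 := by
    intro k t ht
    simp only [hτ]
    rw [hψ0, mul_zero]
    rw [abs_mul, abs_of_pos (hk k)]
    exact (mul_le_mul_of_nonneg_left ht (hk k).le).trans_eq (mul_inv_cancel₀ (hk k).ne')
  have hτle : ∀ k t, |τ k t| ≤ |t| := by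
    intro k t
    simp only [hτ, abs_mul, abs_inv, abs_of_pos (hk k)]
    refine (mul_le_mul_of_nonneg_left (hψle _) (inv_nonneg.2 (hk k).le)).trans_eq ?_
    rw [abs_mul, abs_of_pos (hk k), inv_mul_cancel_left₀ (hk k).ne']
  have hlarge : ∀ t : ℝ, t ≠ 0 → ∀ᶠ k : ℕ in atTop, 2 < |((k : ℝ) + 1) * t| := by
    intro t ht
    obtain ⟨K, hK⟩ := exists_nat_gt (2 / |t|)
    filter_upwards [eventually_ge_atTop K] with k hkK
    rw [abs_mul, abs_of_pos (hk k), ← div_lt_iff₀ (abs_pos.2 ht)]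
    have : (K : ℝ) ≤ k := Nat.cast_le.2 hkK
    linarith
  have htest : ∀ k, IsTest (Ω \ {a}) (fun x => (1 - χ x) * τ k (v x)) := fun k =>
    hv.isTest_mul_truncation hΩ hθ (hnear a ha) (hnear b hb) (hτs k) (inv_pos.2 (hk k)) (hτ0 k)
  have hexp : ∀ k, ∀ x ∈ Ω, gradDot u (fun y => (1 - χ y) * τ k (v y)) x =
      (1 - χ x) * (deriv ψ (((k : ℝ) + 1) * v x) * gradDot u v x)
        - τ k (v x) * gradDot u χ x := by
    intro k x hx
    by_cases hxb : x = b
    · have h0 : (fun y => (1 - χ y) * τ k (v y)) =ᶠ[𝓝 x] fun _ => 0 := by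
        rw [hxb]
        filter_upwards [hb] with y hy
        simp [hy]
      have hb' : χ =ᶠ[𝓝 x] fun _ => 1 := hxb ▸ hb
      rw [gradDot_congr (EventuallyEq.refl _ _) h0, gradDot_congr (EventuallyEq.refl _ _) hb',
        hb'.eq_of_nhds]
      simp [gradDot_const_right]
    · have hvd := hv.smooth.differentiableAt_of_isOpen hv.isOpen_diff (x := x) ⟨hx, hxb⟩
      have hτd' : DifferentiableAt ℝ (τ k) (v x) := (hτs k).differentiable (by simp) _
      have hcd : DifferentiableAt ℝ (fun y => τ k (v y)) x := hτd'.comp x hvd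
      rw [gradDot_mul_right u (hθ.differentiable (by simp) x) hcd,
        gradDot_comp_right u hτd' hvd, gradDot_const_sub_right, hτd]
      ring
  have hi1 : IntegrableOn (fun x => v x * gradDot u χ x) Ω :=
    (integrable_mul_gradDot hv hu hχ hb ha).integrableOn
  have hi2 : IntegrableOn (fun x => (1 - χ x) * gradDot u v x) Ω :=
    hint.bdd_mul (c := 1) hθ.continuous.aestronglyMeasurable (Eventually.of_forall h1)
  have hzero : ∀ k, ∫ x in Ω, gradDot u (fun y => (1 - χ y) * τ k (v y)) x = 0 := by
    intro k
    rw [setIntegral_eq_integral_of_forall_compl_eq_zero, hu.integral_gradDot (htest k)]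
    intro x hx
    have h0 : (fun y => (1 - χ y) * τ k (v y)) =ᶠ[𝓝 x] fun _ => 0 :=
      notMem_tsupport_iff_eventuallyEq.1 fun h => hx ((htest k).supp h).1
    rw [gradDot_congr (EventuallyEq.refl _ _) h0, gradDot_const_right]
  have hmem : ∀ᵐ x ∂volume.restrict Ω, x ∈ Ω := ae_restrict_mem hu.isOpen.measurableSet
  have hlim := tendsto_integral_of_dominated_convergence (μ := volume.restrict Ω)
    (F := fun k x => gradDot u (fun y => (1 - χ y) * τ k (v y)) x)
    (f := fun x => (1 - χ x) * gradDot u v x - v x * gradDot u χ x)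
    (fun x => C * |gradDot u v x| + |v x * gradDot u χ x|)
    (fun k => (integrable_gradDot (htest k) hu.isOpen_diff hu.smooth).aestronglyMeasurable.restrict)
    ((hint.abs.const_mul C).add hi1.abs) ?_ ?_
  · simp only [hzero] at hlim
    have := tendsto_nhds_unique hlim tendsto_const_nhds
    rw [integral_sub hi2 hi1] at this
    linarith
  · intro k
    filter_upwards [hmem] with x hx
    rw [hexp k x hx]
    refine (norm_sub_le _ _).trans (add_le_add ?_ ?_)
    · rw [Real.norm_eq_abs, abs_mul, abs_mul]
      have h2 : |deriv ψ (((k : ℝ) + 1) * v x)| * |gradDot u v x| ≤ C * |gradDot u v x| :=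
        mul_le_mul_of_nonneg_right (hψC _) (abs_nonneg _)
      exact (mul_le_of_le_one_left (by positivity) (h1 x)).trans h2
    · rw [Real.norm_eq_abs, abs_mul, abs_mul (v x)]
      exact mul_le_mul_of_nonneg_right (hτle k _) (abs_nonneg _)
  · filter_upwards [hmem, ae_restrict_of_ae
      (ae_gradDot_eq_zero_of_eq_zero hv.isOpen_diff hv.smooth u)] with x hx hx0
    refine tendsto_const_nhds.congr' ?_
    by_cases hvx : v x = 0
    · filter_upwards with k
      rw [hexp k x hx, hvx, hτ0 k 0 (by simpa using (hk k).le)]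
      by_cases hxb : x = b
      · simp [hxb, hb.eq_of_nhds]
      · simp [hx0 ⟨hx, hxb⟩ hvx]
    · filter_upwards [hlarge _ hvx] with k hkx
      have hd : deriv ψ (((k : ℝ) + 1) * v x) = 1 := by
        have : ψ =ᶠ[𝓝 (((k : ℝ) + 1) * v x)] id := by
          filter_upwards [(isOpen_lt continuous_const continuous_abs).mem_nhds hkx] with s hs
          exact hψ1 s hs
        rw [this.deriv_eq]
        simp
      rw [hexp k x hx, hd, one_mul]
      simp only [hτ]
      rw [hψ1 _ hkx, inv_mul_cancel_left₀ (hk k).ne']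

theorem IsPole.symm (hΩ : Bornology.IsBounded Ω) (hab : a ≠ b) (haΩ : a ∈ Ω) (hbΩ : b ∈ Ω)
    (hu : IsPole Ω a u) (hv : IsPole Ω b v) (hint : IntegrableOn (gradDot u v) Ω) :
    u b = v a := by
  obtain ⟨A, B, hA, hB, haA, hbB, hAB⟩ := t2_separation hab
  obtain ⟨α, hα, hα1, hαI⟩ := exists_isTest_eventuallyEq_one
    (hA.inter hu.isOpen) ⟨haA, haΩ⟩
  obtain ⟨β, hβ, hβ1, hβI⟩ := exists_isTest_eventuallyEq_one
    (hB.inter hu.isOpen) ⟨hbB, hbΩ⟩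
  have hαB : ∀ x ∈ B, x ∉ tsupport α := fun x hx h => hAB.le_bot ⟨(hα.supp h).1, hx⟩
  have hβA : ∀ x ∈ A, x ∉ tsupport β := fun x hx h => hAB.le_bot ⟨hx, (hβ.supp h).1⟩
  have hα0 : α =ᶠ[𝓝 b] fun _ => 0 := notMem_tsupport_iff_eventuallyEq.1 (hαB b hbB)
  have hβ0 : β =ᶠ[𝓝 a] fun _ => 0 := notMem_tsupport_iff_eventuallyEq.1 (hβA a haA)
  have hα' : IsTest Ω α := hα.mono inter_subset_right
  have hβ' : IsTest Ω β := hβ.mono inter_subset_right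
  set χ : 𝔼 → ℝ := fun x => α x + β x with hχdef
  have hχ : IsTest Ω χ := ⟨hα.smooth.add hβ.smooth, hα.compact.add hβ.compact,
    (tsupport_add α β).trans (union_subset hα'.supp hβ'.supp)⟩
  have hχa : χ =ᶠ[𝓝 a] fun _ => 1 := by
    filter_upwards [hα1, hβ0] with x h h'
    simp [hχdef, h, h']
  have hχb : χ =ᶠ[𝓝 b] fun _ => 1 := by
    filter_upwards [hα0, hβ1] with x h h'
    simp [hχdef, h, h']
  have hχI : ∀ x, |1 - χ x| ≤ 1 := by
    intro x
    have h1 := hαI x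
    have h2 := hβI x
    by_cases hx : x ∈ tsupport α
    · have h3 : β x = 0 := image_eq_zero_of_notMem_tsupport (hβA x (hα.supp hx).1)
      rw [abs_le]
      simp only [hχdef, h3]
      constructor <;> linarith [h1.1, h1.2]
    · have h3 : α x = 0 := image_eq_zero_of_notMem_tsupport hx
      rw [abs_le]
      simp only [hχdef, h3]
      constructor <;> linarith [h2.1, h2.2]
  have e1 := hu.apply_eq_integral hv hβ' hβ0 hβ1
  have e2 := hv.apply_eq_integral hu hα' hα0 hα1
  have e3 := hu.setIntegral_mul_gradDot_cutoff hΩ hv hχ hχa hχb hχI hint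
  have e4 := hv.setIntegral_mul_gradDot_cutoff hΩ hu hχ hχb hχa hχI
    (hint.congr_fun (fun x _ => gradDot_comm u v x) hu.isOpen.measurableSet)
  have e5 : ∫ x in Ω, v x * gradDot u χ x = ∫ x in Ω, u x * gradDot v χ x := by
    rw [e3, e4]
    simp only [gradDot_comm u v]
  rw [setIntegral_eq_integral_of_forall_compl_eq_zero (fun x hx => by rw [hv.zero x hx, zero_mul]),
    setIntegral_eq_integral_of_forall_compl_eq_zero (fun x hx => by rw [hu.zero x hx, zero_mul])]
    at e5
  have i1 := integrable_mul_gradDot hu hv hβ' hβ0 hβ1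
  have i2 := integrable_mul_gradDot hv hu hβ' hβ1 hβ0
  have i3 := integrable_mul_gradDot hu hv hα' hα1 hα0
  have i4 := integrable_mul_gradDot hv hu hα' hα0 hα1
  simp only [hχdef, gradDot_add_right _ (hα'.differentiable _) (hβ'.differentiable _),
    mul_add] at e5
  rw [integral_add i4 i2, integral_add i3 i1] at e5
  rw [integral_sub i1 i2] at e1
  rw [integral_sub i4 i3] at e2
  linarith

end Pole

/-- symmetry of the Green function: `G(a,b) = G(b,a)` for distinct `a, b ∈ Ω`. -/
theorem green_symmetric
    {n : ℕ} (hn : 2 ≤ n) (Ω : Set (EuclideanSpace ℝ (Fin n)))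
    (hΩo : IsOpen Ω) (hΩb : Bornology.IsBounded Ω)
    (G : EuclideanSpace ℝ (Fin n) → EuclideanSpace ℝ (Fin n) → ℝ)
    (hG : IsGreen n Ω G)
    (hext : ∀ c ∈ Ω, ∃ F : EuclideanSpace ℝ (Fin n) → ℝ,
        ContDiffOn ℝ 1 F (closure Ω \ {c}) ∧ ∀ x ∈ Ω \ {c}, F x = G x c)
    (hint : ∀ a ∈ Ω, ∀ b ∈ Ω, a ≠ b → IntegrableOn
      (fun x => ∑ i, pd (fun y => G y a) i x * pd (fun y => G y b) i x) Ω volume) :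
    ∀ a ∈ Ω, ∀ b ∈ Ω, a ≠ b → G a b = G b a := by
  intro a ha b hb hab
  have pole : ∀ c ∈ Ω, IsPole Ω c (Ω.indicator fun x => G x c) := by
    intro c hc
    refine ⟨hΩo, ?_, fun x hx => indicator_of_notMem hx _, ?_, ?_⟩
    · exact (hG.smooth c hc).congr fun x hx => indicator_of_mem hx.1 (fun x => G x c)
    · obtain ⟨F, hF, hFG, hF0⟩ := hG.boundary c hc
      have heq : ∀ x ∈ closure Ω \ {c}, Ω.indicator (fun x => G x c) x = F x := by
        intro x hx
        by_cases hxΩ : x ∈ Ω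
        · rw [indicator_of_mem hxΩ, hFG x ⟨hxΩ, hx.2⟩]
        · rw [indicator_of_notMem hxΩ, hF0 x ⟨hx.1, fun h => hxΩ (interior_subset h)⟩]
      intro x hx
      by_cases hxc : x ∈ closure Ω
      · have h1 : ContinuousWithinAt (Ω.indicator fun x => G x c) (closure Ω \ {c}) x :=
          (hF.congr heq) x ⟨hxc, hx⟩
        by_cases hxΩ : x ∈ Ω
        · exact (h1.continuousAt (mem_of_superset ((hΩo.sdiff isClosed_singleton).mem_nhds
            ⟨hxΩ, hx⟩) (sdiff_subset_sdiff_left subset_closure))).continuousWithinAt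
        · have h2 : ContinuousWithinAt (Ω.indicator fun x => G x c) Ωᶜ x :=
            continuousWithinAt_const.congr (fun y hy => indicator_of_notMem hy (fun x => G x c))
              (indicator_of_notMem hxΩ _)
          refine (h1.union h2).mono fun y hy => ?_
          by_cases hyΩ : y ∈ Ω
          · exact Or.inl ⟨subset_closure hyΩ, hy⟩
          · exact Or.inr hyΩ
      · refine ContinuousAt.continuousWithinAt ?_
        refine continuousAt_const (y := (0 : ℝ)) |>.congr ?_
        filter_upwards [isClosed_closure.isOpen_compl.mem_nhds hxc] with y hy
        exact (indicator_of_notMem (fun h => hy (subset_closure h)) _).symm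
    · intro φ hφ
      rw [← hG.distrib c hc φ hφ.smooth hφ.compact hφ.supp,
        ← integral_indicator hΩo.measurableSet]
      refine integral_congr_ae (Eventually.of_forall fun x => ?_)
      by_cases hx : x ∈ Ω <;> simp [hx]
  have hnear : ∀ c, ∀ x ∈ Ω, (fun y => G y c) =ᶠ[𝓝 x] Ω.indicator fun y => G y c := by
    intro c x hx
    filter_upwards [hΩo.mem_nhds hx] with y hy
    exact (indicator_of_mem hy fun y => G y c).symm
  have key := (pole a ha).symm hΩb hab ha hb (pole b hb)
    ((hint a ha b hb hab).congr_fun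
      (fun x hx => gradDot_congr (hnear a x hx) (hnear b x hx)) hΩo.measurableSet)
  rw [indicator_of_mem hb, indicator_of_mem ha] at key
  exact key.symm
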